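/- Let n be a natural number, let ρ : (Fin n → ℝ) → ℝ be a smooth function with ρ x > 0 for all x, and let X, Y : (Fin n → ℝ) → (Fin n → ℝ) be twice continuously differentiable vector fields whose Lie bracket vanishes identically, i.e. DY(x)(X(x)) − DX(x)(Y(x)) = 0 for all x. Then for every x, ∑ i, X x i * D_i (Div_ρ Y) (x) = ∑ i, Y x i * D_i (Div_ρ X) (x). (For commuting vector fields, the derivative of the divergence of one along the other is symmetric; this is the classical case of the proposition that on a Q-manifold the derivative of the divergence of the homological vector field along any symmetry is exact.) -/

import Mathlib

open scoped BigOperators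

/-- The divergence of a vector field `X` on `Fin n → ℝ` with respect to a positive
density `ρ`: `Div_ρ X (x) = (ρ x)⁻¹ * ∑ i, D_i (X^i ρ) (x)`. -/
noncomputable def divRho {n : ℕ} (ρ : (Fin n → ℝ) → ℝ)
    (X : (Fin n → ℝ) → (Fin n → ℝ)) (x : Fin n → ℝ) : ℝ :=
  (ρ x)⁻¹ * ∑ i, fderiv ℝ (fun y => X y i * ρ y) x (Pi.single i 1)

/-- A linear functional on `Fin n → ℝ` is determined by its values on the standard basis. -/
theorem sum_mul_apply_single {n : ℕ} (L : (Fin n → ℝ) →L[ℝ] ℝ) (v : Fin n → ℝ) :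
    ∑ i, v i * L (Pi.single i 1) = L v := by
  conv_rhs => rw [pi_eq_sum_univ' v, map_sum]
  simp

/-- The trace as a continuous linear functional on continuous endomorphisms of `Fin n → ℝ`. -/
noncomputable def traceCLM (n : ℕ) : ((Fin n → ℝ) →L[ℝ] (Fin n → ℝ)) →L[ℝ] ℝ :=
  LinearMap.toContinuousLinearMap
    (LinearMap.trace ℝ (Fin n → ℝ) ∘ₗ ContinuousLinearMap.coeLM ℝ)

theorem traceCLM_comp_comm {n : ℕ} (A B : (Fin n → ℝ) →L[ℝ] (Fin n → ℝ)) :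
    traceCLM n (A.comp B) = traceCLM n (B.comp A) :=
  LinearMap.trace_mul_comm ℝ (A : (Fin n → ℝ) →ₗ[ℝ] (Fin n → ℝ)) B

theorem traceCLM_eq_sum {n : ℕ} (A : (Fin n → ℝ) →L[ℝ] (Fin n → ℝ)) :
    traceCLM n A = ∑ i, A (Pi.single i 1) i := by
  change LinearMap.trace ℝ (Fin n → ℝ) (A : (Fin n → ℝ) →ₗ[ℝ] (Fin n → ℝ)) = _
  rw [LinearMap.trace_eq_matrix_trace ℝ (Pi.basisFun ℝ (Fin n))]
  simp [Matrix.trace]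

/-- The divergence with respect to `ρ` is the trace of the derivative plus the derivative of
`log ρ` along the field. -/
theorem divRho_eq {n : ℕ} {ρ : (Fin n → ℝ) → ℝ} {X : (Fin n → ℝ) → (Fin n → ℝ)}
    {x : Fin n → ℝ} (hρ : DifferentiableAt ℝ ρ x) (hx : ρ x ≠ 0)
    (hX : DifferentiableAt ℝ X x) :
    divRho ρ X x =
      traceCLM n (fderiv ℝ X x) + fderiv ℝ (fun y => Real.log (ρ y)) x (X x) := by
  have hprod : ∀ i, fderiv ℝ (fun y => X y i * ρ y) x (Pi.single i 1) =
      X x i * fderiv ℝ ρ x (Pi.single i 1) + ρ x * fderiv ℝ X x (Pi.single i 1) i := by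
    intro i
    have hXi : HasFDerivAt (fun y => X y i)
        ((ContinuousLinearMap.proj i).comp (fderiv ℝ X x)) x :=
      hasFDerivAt_pi'.1 hX.hasFDerivAt i
    refine (congrArg (fun L => L (Pi.single i 1)) (hXi.mul hρ.hasFDerivAt).fderiv).trans ?_
    simp
  rw [divRho, Finset.sum_congr rfl fun i _ => hprod i, Finset.sum_add_distrib,
    sum_mul_apply_single, ← Finset.mul_sum, ← traceCLM_eq_sum,
    (hρ.hasFDerivAt.log hx).fderiv]
  simp only [smul_apply, smul_eq_mul]
  field_simp
  ring

theorem fderiv_divRho_apply {n : ℕ} {ρ : (Fin n → ℝ) → ℝ} {X : (Fin n → ℝ) → (Fin n → ℝ)}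
    (hρ : ContDiff ℝ 2 ρ) (hpos : ∀ x, 0 < ρ x) (hX : ContDiff ℝ 2 X) (x v : Fin n → ℝ) :
    fderiv ℝ (divRho ρ X) x v =
      traceCLM n (fderiv ℝ (fderiv ℝ X) x v) +
        (fderiv ℝ (fderiv ℝ fun y => Real.log (ρ y)) x v (X x) +
          fderiv ℝ (fun y => Real.log (ρ y)) x (fderiv ℝ X x v)) := by
  have hlog : ContDiff ℝ 2 fun y => Real.log (ρ y) := hρ.log fun y => (hpos y).ne'
  have hDX : DifferentiableAt ℝ (fderiv ℝ X) x :=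
    (hX.fderiv_right (m := 1) (by norm_num)).differentiable (by norm_num) x
  have hDlog : DifferentiableAt ℝ (fderiv ℝ fun y => Real.log (ρ y)) x :=
    (hlog.fderiv_right (m := 1) (by norm_num)).differentiable (by norm_num) x
  have hXx : DifferentiableAt ℝ X x := hX.differentiable (by norm_num) x
  have hdiv : divRho ρ X = fun y =>
      traceCLM n (fderiv ℝ X y) + fderiv ℝ (fun z => Real.log (ρ z)) y (X y) :=
    funext fun y => divRho_eq (hρ.differentiable (by norm_num) y) (hpos y).ne'
      (hX.differentiable (by norm_num) y)
  have hderiv := ((traceCLM n).hasFDerivAt.comp x hDX.hasFDerivAt).add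
    (hDlog.hasFDerivAt.clm_apply hXx.hasFDerivAt)
  rw [hdiv]
  refine (congrArg (fun L => L v) hderiv.fderiv).trans ?_
  simp [add_comm]

/-- Differentiating `[X, Y] = 0` and taking traces: the traces of the second derivatives agree. -/
theorem traceCLM_fderiv_fderiv_comm {n : ℕ} {X Y : (Fin n → ℝ) → (Fin n → ℝ)}
    (hX : ContDiff ℝ 2 X) (hY : ContDiff ℝ 2 Y)
    (hcomm : ∀ x, fderiv ℝ Y x (X x) = fderiv ℝ X x (Y x)) (x : Fin n → ℝ) :
    traceCLM n (fderiv ℝ (fderiv ℝ Y) x (X x)) =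
      traceCLM n (fderiv ℝ (fderiv ℝ X) x (Y x)) := by
  have hasDeriv : ∀ {U V : (Fin n → ℝ) → (Fin n → ℝ)}, ContDiff ℝ 2 U → ContDiff ℝ 2 V →
      HasFDerivAt (fun y => fderiv ℝ V y (U y))
        ((fderiv ℝ V x).comp (fderiv ℝ U x) + fderiv ℝ (fderiv ℝ V) x (U x)) x := by
    intro U V hU hV
    have hDV : DifferentiableAt ℝ (fderiv ℝ V) x :=
      (hV.fderiv_right (m := 1) (by norm_num)).differentiable (by norm_num) x
    refine (hDV.hasFDerivAt.clm_apply
      (hU.differentiable (by norm_num) x).hasFDerivAt).congr_fderiv (congrArg _ ?_)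
    ext1 v
    exact (hV.contDiffAt.isSymmSndFDerivAt (by simp)).eq _ _
  have hYX := hasDeriv hX hY
  rw [funext hcomm] at hYX
  have htrace := congrArg (traceCLM n) (hYX.unique (hasDeriv hY hX))
  rw [map_add, map_add, traceCLM_comp_comm] at htrace
  exact add_left_cancel htrace

/-- For commuting vector fields (vanishing Lie bracket `[X,Y] = DY(X) − DX(Y) = 0`),
the derivative of the divergence of one along the other is symmetric:
`X(Div_ρ Y) = Y(Div_ρ X)`. -/
theorem divRho_symmetry {n : ℕ} (ρ : (Fin n → ℝ) → ℝ)
    (hρ : ContDiff ℝ (⊤ : ℕ∞) ρ) (hρpos : ∀ x, 0 < ρ x)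
    (X Y : (Fin n → ℝ) → (Fin n → ℝ))
    (hX : ContDiff ℝ 2 X) (hY : ContDiff ℝ 2 Y)
    (hcomm : ∀ x, fderiv ℝ Y x (X x) - fderiv ℝ X x (Y x) = 0)
    (x : Fin n → ℝ) :
    ∑ i, X x i * fderiv ℝ (divRho ρ Y) x (Pi.single i 1) =
      ∑ i, Y x i * fderiv ℝ (divRho ρ X) x (Pi.single i 1) := by
  have hρ2 : ContDiff ℝ 2 ρ := hρ.of_le (WithTop.coe_le_coe.2 le_top)
  have hcomm' : ∀ y, fderiv ℝ Y y (X y) = fderiv ℝ X y (Y y) := fun y =>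
    sub_eq_zero.1 (hcomm y)
  have hlog : ContDiff ℝ 2 fun y => Real.log (ρ y) := hρ2.log fun y => (hρpos y).ne'
  rw [sum_mul_apply_single, sum_mul_apply_single, fderiv_divRho_apply hρ2 hρpos hY,
    fderiv_divRho_apply hρ2 hρpos hX, traceCLM_fderiv_fderiv_comm hX hY hcomm', hcomm' x,
    (hlog.contDiffAt.isSymmSndFDerivAt (by simp)).eq (X x) (Y x)]
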